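/- Let Ã be a 2×2 real matrix with nonnegative entries a₁₁, a₁₂, a₂₁, a₂₂, with det(Ã) > 0 and with each row of Ã nonzero. Let α, β ∈ ℝ, not both zero, be such that the vector γ := α(a₁₁, a₁₂)ᵀ + β(a₂₁, a₂₂)ᵀ is nonnegative. Suppose that whenever the matrix Ã_{γ/1} (obtained from Ã by replacing its first row with γᵀ) is nonsingular, ‖Ã⁻¹‖₁ ≤ ‖Ã_{γ/1}⁻¹‖₁, and whenever Ã_{γ/2} (Ã with its second row replaced by γᵀ) is nonsingular, ‖Ã⁻¹‖₁ ≤ ‖Ã_{γ/2}⁻¹‖₁. Then |α − β| ≤ 1; equivalently, ‖(2I₂ − J₂) Ã⁻ᵀ γ‖_∞ ≤ 1. -/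

import Mathlib

open Matrix

/-- The entrywise 1-norm of the inverse of a nonnegative `2 × 2` matrix. -/
theorem sum_abs_inv_fin_two (M : Matrix (Fin 2) (Fin 2) ℝ) (hM : ∀ i j, 0 ≤ M i j) :
    ∑ i, ∑ j, |M⁻¹ i j| = (M 0 0 + M 0 1 + (M 1 0 + M 1 1)) / |M.det| := by
  simp only [Matrix.inv_def, Ring.inverse_eq_inv', Matrix.adjugate_fin_two, Fin.sum_univ_two,
    Matrix.smul_apply, smul_eq_mul, abs_mul, abs_inv, Matrix.of_apply, Matrix.cons_val',
    Matrix.cons_val_zero,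
    Matrix.cons_val_one, Matrix.cons_val_fin_one, abs_neg, abs_of_nonneg (hM _ _)]
  ring

/-- Comparing entrywise 1-norms of inverses of nonnegative `2 × 2` matrices whose determinants
have ratio `t` amounts to comparing the entry sums. -/
theorem abs_mul_sum_le_of_sum_abs_inv_le (A B : Matrix (Fin 2) (Fin 2) ℝ)
    (hA : ∀ i j, 0 ≤ A i j) (hB : ∀ i j, 0 ≤ B i j) (hdet : 0 < A.det) (t : ℝ)
    (hBdet : B.det = t * A.det)
    (h : B.det ≠ 0 → ∑ i, ∑ j, |A⁻¹ i j| ≤ ∑ i, ∑ j, |B⁻¹ i j|) :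
    |t| * (A 0 0 + A 0 1 + (A 1 0 + A 1 1)) ≤ B 0 0 + B 0 1 + (B 1 0 + B 1 1) := by
  rcases eq_or_ne t 0 with rfl | ht
  · simpa using add_nonneg (add_nonneg (hB 0 0) (hB 0 1)) (add_nonneg (hB 1 0) (hB 1 1))
  · have hle := h (hBdet ▸ mul_ne_zero ht hdet.ne')
    have ht' : 0 < |t| := abs_pos.mpr ht
    rw [sum_abs_inv_fin_two A hA, sum_abs_inv_fin_two B hB, hBdet, abs_mul,
      abs_of_pos hdet, div_le_div_iff₀ hdet (mul_pos ht' hdet)] at hle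
    refine le_of_mul_le_mul_right ?_ hdet
    linarith

theorem abs_sub_le_one_of_abs_mul_add_le {r s α β : ℝ} (hr : 0 < r) (hs : 0 < s)
    (hαβ : ¬(α = 0 ∧ β = 0)) (hg : 0 ≤ α * r + β * s)
    (h₁ : |α| * (r + s) ≤ α * r + β * s + s) (h₂ : |β| * (r + s) ≤ r + (α * r + β * s)) :
    |α - β| ≤ 1 := by
  rcases le_total 0 α with ha | ha <;> rcases le_total 0 β with hb | hb
  · rw [abs_of_nonneg ha] at h₁
    rw [abs_of_nonneg hb] at h₂
    rw [abs_le]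
    constructor <;> nlinarith
  · rw [abs_of_nonneg ha] at h₁
    rw [abs_le]
    constructor <;> nlinarith
  · rw [abs_of_nonneg hb] at h₂
    rw [abs_le]
    constructor <;> nlinarith
  · have hα : α = 0 := by nlinarith [mul_nonpos_of_nonpos_of_nonneg hb hs.le]
    have hβ : β = 0 := by nlinarith [mul_nonpos_of_nonpos_of_nonneg ha hr.le]
    exact absurd ⟨hα, hβ⟩ hαβ

/-- Key estimate for rank-2 nonnegative matrices: if `Ã` is a nonnegative
`2 × 2` matrix with positive determinant and nonzero rows that minimizes
`‖·⁻¹‖₁` against replacing either of its rows by the nonnegative combination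
`γ = α (row 1) + β (row 2)` (with `(α, β) ≠ 0`), then `|α - β| ≤ 1`;
equivalently `‖(2 I₂ - J₂) Ã⁻ᵀ γ‖_∞ ≤ 1`. -/
theorem stmt_14 (Atil : Matrix (Fin 2) (Fin 2) ℝ)
    (hnonneg : ∀ i j, 0 ≤ Atil i j) (hdet : 0 < Atil.det)
    (hrows : ∀ i, ∃ j, Atil i j ≠ 0)
    (α β : ℝ) (hαβ : ¬(α = 0 ∧ β = 0))
    (γ : Fin 2 → ℝ) (hγ : γ = fun j => α * Atil 0 j + β * Atil 1 j)
    (hγpos : ∀ j, 0 ≤ γ j)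
    (hmin1 : (Atil.updateRow 0 γ).det ≠ 0 →
      ∑ i, ∑ j, |Atil⁻¹ i j| ≤ ∑ i, ∑ j, |(Atil.updateRow 0 γ)⁻¹ i j|)
    (hmin2 : (Atil.updateRow 1 γ).det ≠ 0 →
      ∑ i, ∑ j, |Atil⁻¹ i j| ≤ ∑ i, ∑ j, |(Atil.updateRow 1 γ)⁻¹ i j|)
    (J : Matrix (Fin 2) (Fin 2) ℝ) (hJ : J = of fun _ _ => (1 : ℝ)) :
    |α - β| ≤ 1 ∧
    ∀ i, |((2 • (1 : Matrix (Fin 2) (Fin 2) ℝ) - J) * Atil⁻¹ᵀ).mulVec γ i|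
      ≤ 1 := by
  have hrow : ∀ i, 0 < Atil i 0 + Atil i 1 := by
    intro i
    obtain ⟨j, hj⟩ := hrows i
    have hpos := lt_of_le_of_ne (hnonneg i j) hj.symm
    have h0 := hnonneg i 0
    have h1 := hnonneg i 1
    fin_cases j <;> simp at hpos <;> linarith
  have hupd : ∀ k i j, 0 ≤ Atil.updateRow k γ i j := by
    intro k i j
    rw [Matrix.updateRow_apply]
    split_ifs
    exacts [hγpos j, hnonneg i j]
  have h₁ := abs_mul_sum_le_of_sum_abs_inv_le Atil _ hnonneg (hupd 0) hdet α
    (by simp [Matrix.det_fin_two, Matrix.updateRow_apply, hγ]; ring) hmin1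
  have h₂ := abs_mul_sum_le_of_sum_abs_inv_le Atil _ hnonneg (hupd 1) hdet β
    (by simp [Matrix.det_fin_two, Matrix.updateRow_apply, hγ]; ring) hmin2
  simp [Matrix.updateRow_apply, hγ] at h₁ h₂
  have hg0 := hγpos 0
  have hg1 := hγpos 1
  simp only [hγ] at hg0 hg1
  have key : |α - β| ≤ 1 :=
    abs_sub_le_one_of_abs_mul_add_le (hrow 0) (hrow 1) hαβ (by linarith) (by linarith)
      (by linarith)
  refine ⟨key, ?_⟩
  have hγ' : γ = Atilᵀ *ᵥ ![α, β] := by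
    rw [hγ]
    ext j
    simp [Matrix.mulVec, dotProduct, Fin.sum_univ_two, mul_comm]
  have hinv : Atil⁻¹ᵀ *ᵥ γ = ![α, β] := by
    rw [hγ', Matrix.mulVec_mulVec, ← Matrix.transpose_mul,
      Matrix.mul_nonsing_inv _ (isUnit_iff_ne_zero.mpr hdet.ne'), Matrix.transpose_one,
      Matrix.one_mulVec]
  intro i
  rw [← Matrix.mulVec_mulVec, hinv, hJ, two_smul]
  rw [abs_le] at key ⊢
  fin_cases i <;> simp [Matrix.mulVec, dotProduct, Fin.sum_univ_two, Matrix.one_apply] <;>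
    constructor <;> linarith
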